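/- Let K_n be the multiplicative subgroup of the nonzero complex numbers generated by {1 + ω_n^j : 0 ≤ j < n}. If n ≥ 3 and n ∈ O_FS, then the rank of K_n equals φ(n)/2, where φ is Euler's totient function. Moreover, the rank of K_1 equals 1. -/

import Mathlib

open TensorProduct

/-- The primitive `n`-th root of unity `exp(2πi/n)`. -/
noncomputable def omega (n : ℕ) : ℂ := Complex.exp (2 * Real.pi * Complex.I / n)

/-- The multiplicative subgroup `K_n` of `ℂ*` generated by `{1 + ω_n^j : 0 ≤ j < n}`. -/
noncomputable def Kgrp (n : ℕ) : Subgroup ℂˣ :=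
  Subgroup.closure {u : ℂˣ | ∃ j : ℕ, j < n ∧ (u : ℂ) = 1 + omega n ^ j}

/-- The rank of an abelian group: the dimension of `G ⊗_ℤ ℚ` over `ℚ`. -/
noncomputable def groupRank (H : Type*) [CommGroup H] : Cardinal :=
  Module.rank ℚ (ℚ ⊗[ℤ] Additive H)

/-- `O_FS` : odd naturals `n ≥ 1` such that `(ℤ/nℤ)*` is covered by `{±2^j : j ≥ 0}`. -/
def OFS (n : ℕ) : Prop :=
  Odd n ∧ 1 ≤ n ∧ ∀ x : ℤ, IsCoprime x (n : ℤ) →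
    ∃ j : ℕ, (n : ℤ) ∣ x - 2 ^ j ∨ (n : ℤ) ∣ x + 2 ^ j


lemma abel_sum (w : ℂ) (a : ℕ → ℂ) (h : Summable fun n => w ^ n * a n) :
    (1 - w) * ∑' n, w ^ n * a n = a 0 + ∑' n, w ^ (n + 1) * (a (n + 1) - a n) := by
  have h1 := (summable_nat_add_iff 1).2 h
  have h2 : Summable fun n => w ^ (n + 1) * a n := by
    have := h.mul_left w
    refine this.congr fun n => ?_
    ring
  have e1 := h.tsum_eq_zero_add
  have e2 : w * ∑' n, w ^ n * a n = ∑' n, w ^ (n + 1) * a n := by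
    rw [← tsum_mul_left]
    exact tsum_congr fun n => by ring
  rw [sub_mul, one_mul, e2]
  simp_rw [mul_sub]
  rw [h1.tsum_sub h2, e1]
  simp
  ring

lemma rpow_diff_bound (s : ℝ) (h1 : 1 ≤ s) (h2 : s ≤ 2) (n : ℕ) :
    |((n : ℝ) + 1 + 1) ^ (-s) - ((n : ℝ) + 1) ^ (-s)| ≤ 2 * (1 / ((n : ℝ) + 1) ^ 2) := by
  have hn : (0 : ℝ) < (n : ℝ) + 1 := by positivity
  set x : ℝ := ((n : ℝ) + 1) / (n + 1 + 1) with hx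
  have hx0 : 0 < x := by positivity
  have hx1 : x ≤ 1 := by rw [hx, div_le_one (by positivity)]; linarith
  have hxs : x ^ s ≤ 1 := Real.rpow_le_one hx0.le hx1 (by linarith)
  have hxs2 : x ^ 2 ≤ x ^ s := by
    rw [← Real.rpow_natCast]
    exact Real.rpow_le_rpow_of_exponent_ge hx0 hx1 (by simpa using h2)
  have e : ((n : ℝ) + 1 + 1) ^ (-s) = ((n : ℝ) + 1) ^ (-s) * x ^ s := by
    rw [hx, Real.div_rpow hn.le (by positivity), Real.rpow_neg hn.le, Real.rpow_neg (by positivity)]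
    have : ((n : ℝ) + 1) ^ s ≠ 0 := (Real.rpow_pos_of_pos hn _).ne'
    field_simp
  have hb : ((n : ℝ) + 1) ^ (-s) ≤ 1 / ((n : ℝ) + 1) := by
    rw [Real.rpow_neg hn.le, ← one_div]
    apply one_div_le_one_div_of_le hn
    calc (n : ℝ) + 1 = ((n : ℝ) + 1) ^ (1 : ℝ) := by simp
      _ ≤ _ := Real.rpow_le_rpow_of_exponent_le (by linarith [Nat.cast_nonneg (α := ℝ) n]) h1
  have hb0 : 0 < ((n : ℝ) + 1) ^ (-s) := Real.rpow_pos_of_pos hn _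
  rw [e, abs_sub_comm, abs_of_nonneg (by nlinarith)]
  calc ((n : ℝ) + 1) ^ (-s) - ((n : ℝ) + 1) ^ (-s) * x ^ s
      = ((n : ℝ) + 1) ^ (-s) * (1 - x ^ s) := by ring
    _ ≤ 1 / ((n : ℝ) + 1) * (1 - x ^ 2) := by
        apply mul_le_mul hb (by linarith) (by linarith) (by positivity)
    _ ≤ 1 / ((n : ℝ) + 1) * (2 * (1 / ((n : ℝ) + 1))) := by
        apply mul_le_mul_of_nonneg_left _ (by positivity)
        have : 1 - x = 1 / ((n : ℝ) + 1 + 1) := by rw [hx]; field_simp; ring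
        have h3 : 1 - x ≤ 1 / ((n : ℝ) + 1) := by
          rw [this]; exact one_div_le_one_div_of_le hn (by linarith)
        nlinarith
    _ = _ := by field_simp

lemma summable_bd : Summable fun n : ℕ => 2 * (1 / ((n : ℝ) + 1) ^ 2) := by
  apply Summable.mul_left
  have := (summable_nat_add_iff 1).2 (Real.summable_one_div_nat_pow.2 (show 1 < 2 by norm_num))
  simpa using this

/-- the limit series -/
noncomputable def limS (z : ℂ) : ℂ :=
  1 + ∑' n : ℕ, z ^ (n + 1) * (((((n : ℝ) + 1 + 1) ^ (-1 : ℝ) - ((n : ℝ) + 1) ^ (-1 : ℝ) : ℝ)) : ℂ)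

open Filter Topology

lemma tendsto_s (z : ℂ) (hz : ‖z‖ = 1) (hz1 : z ≠ 1) :
    Tendsto (fun s : ℝ => ∑' n : ℕ, z ^ n * ((((n : ℝ) + 1) ^ (-s) : ℝ) : ℂ)) (𝓝[>] 1)
      (𝓝 (limS z / (1 - z))) := by
  have hz' : 1 - z ≠ 0 := sub_ne_zero.2 hz1.symm
  have key : Tendsto (fun s : ℝ => 1 + ∑' n : ℕ, z ^ (n + 1) *
      (((((n : ℝ) + 1 + 1) ^ (-s : ℝ) - ((n : ℝ) + 1) ^ (-s : ℝ) : ℝ)) : ℂ)) (𝓝[>] 1) (𝓝 (limS z)) := by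
    unfold limS
    apply Tendsto.const_add
    apply tendsto_tsum_of_dominated_convergence summable_bd
    · intro n
      apply Tendsto.mono_left _ nhdsWithin_le_nhds
      apply ContinuousAt.tendsto (f := fun s : ℝ => z ^ (n + 1) *
      (((((n : ℝ) + 1 + 1) ^ (-s : ℝ) - ((n : ℝ) + 1) ^ (-s : ℝ) : ℝ)) : ℂ))
      have h1 : (n : ℝ) + 1 ≠ 0 := by positivity
      have h2 : (n : ℝ) + 1 + 1 ≠ 0 := by positivity
      apply ContinuousAt.mul continuousAt_const
      apply Complex.continuous_ofReal.continuousAt.comp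
      apply ContinuousAt.sub
      · exact (Real.continuousAt_const_rpow h2).comp continuous_neg.continuousAt
      · exact (Real.continuousAt_const_rpow h1).comp continuous_neg.continuousAt
    · filter_upwards [Ioo_mem_nhdsGT (show (1 : ℝ) < 2 by norm_num)] with s hs n
      rw [norm_mul, norm_pow, hz, one_pow, one_mul, Complex.norm_real, Real.norm_eq_abs]
      exact rpow_diff_bound s hs.1.le hs.2.le n
  refine (key.div_const (1 - z)).congr' ?_
  filter_upwards [self_mem_nhdsWithin] with s hs
  have hs : 1 < s := hs
  rw [div_eq_iff hz', mul_comm, abel_sum]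
  · simp
  · apply Summable.of_norm
    have := (summable_nat_add_iff 1).2 (Real.summable_nat_rpow.2 (show -s < -1 by linarith))
    refine this.congr fun n => ?_
    rw [norm_mul, norm_pow, hz, one_pow, one_mul, Complex.norm_real, Real.norm_eq_abs,
      abs_of_pos (by positivity)]
    simp

lemma limS_log (z : ℂ) (hz : ‖z‖ = 1) (hz1 : z ≠ 1) :
    z * (limS z / (1 - z)) = - Complex.log (1 - z) := by
  have hz' : 1 - z ≠ 0 := sub_ne_zero.2 hz1.symm
  have hre : z.re < 1 := by
    have h1 := Complex.re_le_norm z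
    rcases (hz ▸ h1).lt_or_eq with h | h
    · exact h
    · exfalso; apply hz1
      have h2 := Complex.sq_norm z
      rw [hz, Complex.normSq_apply, h] at h2
      apply Complex.ext
      · simpa using h
      · simp; nlinarith
  have hslit : 1 - z ∈ Complex.slitPlane := by left; simpa using hre
  have key : Tendsto (fun r : ℝ => (r * z) * (1 + ∑' n : ℕ, (r * z) ^ (n + 1) *
      (((((n : ℝ) + 1 + 1) ^ (-1 : ℝ) - ((n : ℝ) + 1) ^ (-1 : ℝ) : ℝ)) : ℂ))) (𝓝[<] 1) (𝓝 (z * limS z)) := by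
    have hr : Tendsto (fun r : ℝ => (r : ℂ) * z) (𝓝[<] 1) (𝓝 z) := by
      apply Tendsto.mono_left _ nhdsWithin_le_nhds
      have : Continuous fun r : ℝ => (r : ℂ) * z := by fun_prop
      simpa using this.tendsto 1
    refine hr.mul ?_
    unfold limS
    apply Tendsto.const_add
    apply tendsto_tsum_of_dominated_convergence summable_bd
    · intro n
      exact (hr.pow (n + 1)).mul_const _
    · filter_upwards [Ioo_mem_nhdsLT (show (0 : ℝ) < 1 by norm_num)] with r hr n
      rw [norm_mul, norm_pow, norm_mul, hz, mul_one, Complex.norm_real, Complex.norm_real,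
        Real.norm_eq_abs, Real.norm_eq_abs, abs_of_pos hr.1]
      have h1 : r ^ (n + 1) ≤ 1 := pow_le_one₀ hr.1.le hr.2.le
      exact (mul_le_of_le_one_left (abs_nonneg _) h1).trans
        (rpow_diff_bound 1 le_rfl (by norm_num) n)
  have key2 : Tendsto (fun r : ℝ => (1 - r * z) * (- Complex.log (1 - r * z))) (𝓝[<] 1)
      (𝓝 ((1 - z) * (- Complex.log (1 - z)))) := by
    apply Tendsto.mono_left _ nhdsWithin_le_nhds
    have h1 : Continuous fun r : ℝ => 1 - (r : ℂ) * z := by fun_prop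
    have h2 : ContinuousAt (fun r : ℝ => (1 - r * z) * (- Complex.log (1 - r * z))) 1 := by
      apply h1.continuousAt.mul
      apply ContinuousAt.neg
      apply h1.continuousAt.clog
      simpa using hslit
    simpa using h2.tendsto
  have := tendsto_nhds_unique (key.congr' ?_) key2
  · rw [← mul_div_assoc, this, mul_div_cancel_left₀ _ hz']
  filter_upwards [Ioo_mem_nhdsLT (show (0 : ℝ) < 1 by norm_num)] with r hr
  have hn : ‖(r : ℂ) * z‖ < 1 := by
    rw [norm_mul, hz, mul_one, Complex.norm_real, Real.norm_eq_abs, abs_of_pos hr.1]; exact hr.2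
  have hs := Complex.hasSum_taylorSeries_neg_log hn
  generalize (r : ℂ) * z = w at *
  have hs1 : HasSum (fun n : ℕ => w * (w ^ n * ((((n : ℝ) + 1) ^ (-1 : ℝ) : ℝ) : ℂ)))
      (- Complex.log (1 - w)) := by
    have := (hasSum_nat_add_iff' 1).2 hs
    simp only [Finset.range_one, Finset.sum_singleton, pow_zero, CharP.cast_eq_zero, div_zero,
      sub_zero] at this
    refine this.congr_fun fun n => ?_
    rw [Real.rpow_neg_one]
    push_cast
    rw [pow_succ]; ring
  rw [← hs1.tsum_eq, tsum_mul_left, mul_left_comm (1 - w), abel_sum]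
  · simp
  · by_cases hw : w = 0
    · subst hw
      apply summable_of_ne_finset_zero (s := {0})
      intro n hn
      simp at hn; simp [hn]
    · exact (summable_mul_left_iff hw).1 hs1.summable

lemma expZeta_one (N : ℕ) [NeZero N] (j : ZMod N) (hj : j ≠ 0) :
    HurwitzZeta.expZeta (ZMod.toAddCircle j) 1 = - Complex.log (1 - ZMod.stdAddChar j) := by
  set z : ℂ := ZMod.stdAddChar j with hzdef
  have hz : ‖z‖ = 1 := by rw [hzdef, ZMod.stdAddChar_apply]; exact Circle.norm_coe _
  have hz1 : z ≠ 1 := by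
    intro h
    apply hj
    apply ZMod.injective_stdAddChar
    rw [← hzdef, h]; simp
  have hze : z = Complex.exp (2 * Real.pi * Complex.I * ((j.val / N : ℝ) : ℂ)) := by
    rw [hzdef, ZMod.stdAddChar_apply, ZMod.toCircle_apply]
    push_cast
    congr 1; ring
  have hc : Tendsto (fun s : ℝ => HurwitzZeta.expZeta (ZMod.toAddCircle j) (s : ℂ)) (𝓝[>] 1)
      (𝓝 (HurwitzZeta.expZeta (ZMod.toAddCircle j) 1)) := by
    apply Tendsto.mono_left _ nhdsWithin_le_nhds
    have h := (HurwitzZeta.differentiable_expZeta_of_ne_zero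
      (a := ZMod.toAddCircle j) (by simpa using hj)).continuous
    have := (h.comp Complex.continuous_ofReal).tendsto 1
    simpa [Function.comp_def] using this
  rw [← limS_log z hz hz1]
  refine tendsto_nhds_unique hc (((tendsto_s z hz hz1).const_mul z).congr' ?_)
  filter_upwards [self_mem_nhdsWithin] with s hs
  have hs : 1 < s := hs
  rw [ZMod.toAddCircle_apply]
  have h := HurwitzZeta.hasSum_expZeta_of_one_lt_re (j.val / N) (s := (s : ℂ)) (by simpa using hs)
  have h1 := (hasSum_nat_add_iff' 1).2 h
  have hs0 : s ≠ 0 := by linarith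
  simp only [Finset.range_one, Finset.sum_singleton, CharP.cast_eq_zero, mul_zero,
    Complex.exp_zero] at h1
  rw [Complex.zero_cpow (by exact_mod_cast hs0), div_zero, sub_zero] at h1
  rw [← h1.tsum_eq, ← tsum_mul_left]
  refine tsum_congr fun n => ?_
  have e1 : Complex.exp (2 * Real.pi * Complex.I * ((j.val / N : ℝ) : ℂ) * ((n + 1 : ℕ) : ℂ)) = z ^ (n + 1) := by
    rw [hze, ← Complex.exp_nat_mul]; congr 1; ring
  rw [e1, Real.rpow_neg (by positivity), Complex.ofReal_inv, Complex.ofReal_cpow (by positivity),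
    pow_succ]
  push_cast
  rw [div_eq_mul_inv]; ring

lemma log_add_log_conj (N : ℕ) [NeZero N] (j : ZMod N) (hj : j ≠ 0) :
    Complex.log (1 - ZMod.stdAddChar j) + Complex.log (1 - ZMod.stdAddChar (-j)) =
      2 * (Real.log ‖1 - (ZMod.stdAddChar j : ℂ)‖ : ℂ) := by
  set z : ℂ := ZMod.stdAddChar j with hzdef
  have hz : ‖z‖ = 1 := by rw [hzdef, ZMod.stdAddChar_apply]; exact Circle.norm_coe _
  have hz1 : z ≠ 1 := by
    intro h
    apply hj
    apply ZMod.injective_stdAddChar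
    rw [← hzdef, h]; simp
  have hre : z.re < 1 := by
    have h1 := Complex.re_le_norm z
    rcases (hz ▸ h1).lt_or_eq with h | h
    · exact h
    · exfalso; apply hz1
      have h2 := Complex.sq_norm z
      rw [hz, Complex.normSq_apply, h] at h2
      apply Complex.ext
      · simpa using h
      · simp; nlinarith
  have hslit : 1 - z ∈ Complex.slitPlane := by left; simpa using hre
  have hneg : (ZMod.stdAddChar (-j) : ℂ) = (starRingEnd ℂ) z := by
    rw [AddChar.map_neg_eq_inv, ← hzdef, Complex.inv_eq_conj hz]
  rw [hneg, show 1 - (starRingEnd ℂ) z = (starRingEnd ℂ) (1 - z) by simp,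
    Complex.log_conj _ (Complex.slitPlane_arg_ne_pi hslit), Complex.add_conj, Complex.log_re]
  push_cast; rfl

open ZMod in
lemma exists_sum_ne_zero (N : ℕ) [NeZero N] (χ : DirichletCharacter ℂ N) (hχ : χ ≠ 1)
    (he : χ (-1) = 1) :
    ∃ j : ZMod N, ∑ b : (ZMod N)ˣ, χ⁻¹ b * (Real.log ‖1 - (stdAddChar ((b : ZMod N) * j) : ℂ)‖ : ℂ) ≠ 0 := by
  by_contra hcon
  push Not at hcon
  set Φ : ZMod N → ℂ := 𝓕 (χ : ZMod N → ℂ) with hΦ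
  have hev : ∀ j, χ (-j) = χ j := fun j => by
    rw [← neg_one_mul, map_mul, he, one_mul]
  have h0 : Φ 0 = 0 := by
    rw [hΦ, dft_apply_zero]
    exact MulChar.sum_eq_zero_of_ne_one hχ
  have hΦe : ∀ j, Φ (-j) = Φ j := fun j => by
    have := congrFun (dft_comp_neg (χ : ZMod N → ℂ)) j
    simp only [hev] at this
    exact this.symm
  have hΦb : ∀ (b : (ZMod N)ˣ) (j : ZMod N), Φ (b * j) = χ⁻¹ b * Φ j := fun b j => by
    have := dft_comp_unitMul (χ : ZMod N → ℂ) b⁻¹ j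
    rw [inv_inv] at this
    rw [hΦ, ← this]
    simp only [map_mul]
    have h2 := dft_const_mul (χ ((b⁻¹ : (ZMod N)ˣ) : ZMod N)) (χ : ZMod N → ℂ)
    rw [h2]
    rw [MulChar.inv_apply]
    simp
  have hL : LFunction (𝓕 Φ) 1 ≠ 0 := by
    have : 𝓕 Φ = fun j => (N : ℂ) * χ j := by
      rw [hΦ, dft_dft]; funext j; simp [hev]
    have h3 : LFunction (𝓕 Φ) 1 = N * DirichletCharacter.LFunction χ 1 := by
      rw [this]
      simp only [DirichletCharacter.LFunction, LFunction, Finset.mul_sum]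
      exact Finset.sum_congr rfl fun j _ => by ring
    rw [h3]
    exact mul_ne_zero (NeZero.ne _) (DirichletCharacter.LFunction_apply_one_ne_zero hχ)
  rw [LFunction_dft Φ (Or.inl h0)] at hL
  have hS : ∑ j, Φ j * HurwitzZeta.expZeta (toAddCircle (-j)) 1 =
      - ∑ j, Φ j * (Real.log ‖1 - (stdAddChar j : ℂ)‖ : ℂ) := by
    have h1 : ∑ j, Φ j * HurwitzZeta.expZeta (toAddCircle (-j)) 1 =
      ∑ j, Φ j * HurwitzZeta.expZeta (toAddCircle j) 1 := by
      refine Fintype.sum_equiv (.neg _) _ _ fun j => ?_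
      simp [hΦe]
    have h2 : ∑ j, Φ j * HurwitzZeta.expZeta (toAddCircle (-j)) 1 +
      ∑ j, Φ j * HurwitzZeta.expZeta (toAddCircle j) 1 =
      2 * - ∑ j, Φ j * (Real.log ‖1 - (stdAddChar j : ℂ)‖ : ℂ) := by
      rw [← Finset.sum_add_distrib, ← Finset.sum_neg_distrib, Finset.mul_sum]
      refine Finset.sum_congr rfl fun j _ => ?_
      by_cases hj : j = 0
      · rw [hj, h0]; simp
      · rw [expZeta_one _ _ hj, expZeta_one _ _ (neg_ne_zero.2 hj)]
        linear_combination - Φ j * log_add_log_conj N j hj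
    rw [← h1] at h2
    linear_combination h2 / 2
  apply hL
  rw [hS, neg_eq_zero]
  have h4 : ∀ b : (ZMod N)ˣ, ∑ j, Φ j * (Real.log ‖1 - (stdAddChar j : ℂ)‖ : ℂ) =
      ∑ j, Φ j * (χ⁻¹ b * (Real.log ‖1 - (stdAddChar ((b : ZMod N) * j) : ℂ)‖ : ℂ)) := fun b => by
    symm
    refine Fintype.sum_equiv b.mulLeft _ _ fun j => ?_
    simp only [Units.mulLeft_apply, hΦb]
    ring
  have h5 : (Fintype.card (ZMod N)ˣ : ℂ) * ∑ j, Φ j * (Real.log ‖1 - (stdAddChar j : ℂ)‖ : ℂ) = 0 := by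
    rw [← nsmul_eq_mul, ← Finset.card_univ, ← Finset.sum_const]
    rw [Finset.sum_congr rfl fun b _ => h4 b, Finset.sum_comm]
    refine Finset.sum_eq_zero fun j _ => ?_
    rw [← Finset.mul_sum, hcon j, mul_zero]
  exact (mul_eq_zero.1 h5).resolve_left (by exact_mod_cast Fintype.card_ne_zero)

lemma groupRank_eq (H : Type) [CommGroup H] : groupRank H = Module.rank ℤ (Additive H) :=
  (TensorProduct.isBaseChange ℤ (Additive H) ℚ).rank_eq

lemma le_groupRank (H : Type) [CommGroup H] {V : Type} [AddCommGroup V] [Module ℂ V]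
    (f : Additive H →+ V) {ι : Type} (v : ι → V) (hv : LinearIndependent ℂ v)
    (hm : ∀ i, v i ∈ Submodule.span ℂ (Set.range f)) : Cardinal.mk ι ≤ groupRank H := by
  rw [groupRank_eq, ← (TensorProduct.isBaseChange ℤ (Additive H) ℂ).rank_eq]
  let F : ℂ ⊗[ℤ] Additive H →ₗ[ℂ] V :=
    (TensorProduct.isBaseChange ℤ (Additive H) ℂ).lift f.toIntLinearMap
  have hF : ∀ x, F (1 ⊗ₜ x) = f x := fun x =>
    (TensorProduct.isBaseChange ℤ (Additive H) ℂ).lift_eq f.toIntLinearMap x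
  have h1 : ∀ i, v i ∈ LinearMap.range F := fun i => by
    refine Submodule.span_le.2 ?_ (hm i)
    rintro _ ⟨x, rfl⟩
    exact ⟨_, hF x⟩
  choose w hw using h1
  have : LinearIndependent ℂ w := by
    apply LinearIndependent.of_comp F
    convert hv using 1
    funext i; exact hw i
  exact this.cardinal_le_rank

lemma omega_pow (n : ℕ) [NeZero n] (j : ℕ) : omega n ^ j = ZMod.stdAddChar (j : ZMod n) := by
  have := ZMod.stdAddChar_coe (N := n) (j : ℤ)
  rw [Int.cast_natCast] at this
  rw [this, omega, ← Complex.exp_nat_mul]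
  congr 1
  push_cast
  ring

lemma chi_one (n : ℕ) [NeZero n] (h : OFS n) (χ : DirichletCharacter ℂ n) (he : χ (-1) = 1)
    (h2 : χ 2 = 1) : χ = 1 := by
  ext b
  rw [MulChar.one_apply_coe]
  have hc : IsCoprime ((b : ZMod n).val : ℤ) (n : ℤ) :=
    Nat.isCoprime_iff_coprime.2 (ZMod.val_coe_unit_coprime b)
  obtain ⟨j, hj | hj⟩ := h.2.2 _ hc
  · have := (ZMod.intCast_zmod_eq_zero_iff_dvd _ n).2 hj
    push_cast at this
    rw [ZMod.natCast_zmod_val, sub_eq_zero] at this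
    rw [this, map_pow, h2, one_pow]
  · have := (ZMod.intCast_zmod_eq_zero_iff_dvd _ n).2 hj
    push_cast at this
    rw [ZMod.natCast_zmod_val] at this
    rw [eq_neg_of_add_eq_zero_left this, ← neg_one_mul, map_mul, he, map_pow, h2, one_pow, one_mul]

lemma exists_plus (n : ℕ) [NeZero n] (h : OFS n) (χ : DirichletCharacter ℂ n) (he : χ (-1) = 1) :
    ∃ j : ZMod n, ∑ b : (ZMod n)ˣ, χ⁻¹ b *
      (Real.log ‖1 + (ZMod.stdAddChar ((b : ZMod n) * j) : ℂ)‖ : ℂ) ≠ 0 := by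
  by_cases hχ : χ = 1
  · refine ⟨0, ?_⟩
    subst hχ
    have h2 : Real.log ‖(1 : ℂ) + 1‖ ≠ 0 := by
      rw [one_add_one_eq_two, Complex.norm_two]; exact (Real.log_pos (by norm_num)).ne'
    simp only [mul_zero, AddChar.map_zero_eq_one, inv_one, MulChar.one_apply_coe, one_mul,
      Finset.sum_const, Finset.card_univ, nsmul_eq_mul]
    exact mul_ne_zero (by exact_mod_cast Fintype.card_ne_zero) (by exact_mod_cast h2)
  · obtain ⟨j, hj⟩ := exists_sum_ne_zero n χ hχ he
    refine ⟨j, ?_⟩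
    have hcop : Nat.Coprime 2 n := Nat.coprime_two_left.2 h.1
    let t : (ZMod n)ˣ := ZMod.unitOfCoprime 2 hcop
    have ht : (t : ZMod n) = 2 := by simp [t]
    have hj0 : j ≠ 0 := by
      rintro rfl
      apply hj
      simp
    have hlog : ∀ x : ZMod n, x ≠ 0 → Real.log ‖1 + (ZMod.stdAddChar x : ℂ)‖ =
        Real.log ‖1 - (ZMod.stdAddChar ((t : ZMod n) * x) : ℂ)‖ - Real.log ‖1 - (ZMod.stdAddChar x : ℂ)‖ := by
      intro x hx
      have hne : ∀ y : ZMod n, y ≠ 0 → ‖1 - (ZMod.stdAddChar y : ℂ)‖ ≠ 0 := fun y hy => by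
        rw [norm_ne_zero_iff, sub_ne_zero]
        intro h
        apply hy
        apply ZMod.injective_stdAddChar
        rw [← h]; simp
      have htx : (t : ZMod n) * x ≠ 0 := by simpa using hx
      have e : 1 - (ZMod.stdAddChar ((t : ZMod n) * x) : ℂ) =
          (1 + ZMod.stdAddChar x) * (1 - ZMod.stdAddChar x) := by
        rw [ht, two_mul, AddChar.map_add_eq_mul]; ring
      have h1 := hne _ htx
      have h2 := hne _ hx
      rw [e, norm_mul] at h1 ⊢
      rw [Real.log_mul (left_ne_zero_of_mul h1) h2]; ring
    have hsum : ∑ b : (ZMod n)ˣ, χ⁻¹ b *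
        (Real.log ‖1 + (ZMod.stdAddChar ((b : ZMod n) * j) : ℂ)‖ : ℂ) =
        (χ 2 - 1) * ∑ b : (ZMod n)ˣ, χ⁻¹ b *
        (Real.log ‖1 - (ZMod.stdAddChar ((b : ZMod n) * j) : ℂ)‖ : ℂ) := by
      have h3 : χ 2 * ∑ b : (ZMod n)ˣ, χ⁻¹ b *
        (Real.log ‖1 - (ZMod.stdAddChar ((b : ZMod n) * j) : ℂ)‖ : ℂ) =
        ∑ b : (ZMod n)ˣ, χ⁻¹ b *
        (Real.log ‖1 - (ZMod.stdAddChar ((t : ZMod n) * ((b : ZMod n) * j)) : ℂ)‖ : ℂ) := by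
        rw [Finset.mul_sum]
        symm
        refine Fintype.sum_equiv (Equiv.mulLeft t) _ _ fun b => ?_
        simp only [Equiv.coe_mulLeft, Units.val_mul, map_mul, mul_assoc]
        rw [← ht]
        have : χ t * χ⁻¹ t = 1 := by
          rw [← MulChar.mul_apply, mul_inv_cancel, MulChar.one_apply_coe]
        linear_combination (- χ⁻¹ b * (Real.log ‖1 - (ZMod.stdAddChar ((t : ZMod n) * ((b : ZMod n) * j)) : ℂ)‖ : ℂ)) * this
      rw [sub_mul, h3, one_mul, ← Finset.sum_sub_distrib]
      refine Finset.sum_congr rfl fun b _ => ?_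
      rw [hlog _ (by simpa using hj0)]
      push_cast; ring
    rw [hsum]
    refine mul_ne_zero (sub_ne_zero.2 fun h2 => hχ (chi_one n h χ he h2)) hj

lemma card_even (n : ℕ) [NeZero n] (hn : 3 ≤ n) :
    Nat.card {χ : DirichletCharacter ℂ n // χ (-1) = 1} = n.totient / 2 := by
  classical
  have hne : (-1 : ZMod n) ≠ 1 := by
    have : Fact (2 < n) := ⟨hn⟩
    exact ZMod.neg_one_ne_one
  have h0 := DirichletCharacter.sum_characters_eq_zero ℂ hne
  have hc := DirichletCharacter.card_eq_totient_of_hasEnoughRootsOfUnity ℂ n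
  have h1 : ∀ χ : DirichletCharacter ℂ n, χ (-1) = 2 * (if χ (-1) = 1 then 1 else 0) - 1 := by
    intro χ
    have hs : χ (-1) * χ (-1) = 1 := by rw [← map_mul]; simp
    rcases mul_self_eq_one_iff.1 hs with h | h <;> rw [h] <;> norm_num
  rw [Finset.sum_congr rfl fun χ _ => h1 χ, Finset.sum_sub_distrib, ← Finset.mul_sum,
    Finset.sum_boole] at h0
  simp only [Finset.sum_const, Finset.card_univ, nsmul_eq_mul, mul_one] at h0
  rw [Nat.card_eq_fintype_card] at hc
  rw [hc] at h0
  have h2 : 2 * (Finset.univ.filter fun χ : DirichletCharacter ℂ n => χ (-1) = 1).card = n.totient := by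
    exact_mod_cast sub_eq_zero.1 h0
  rw [Nat.card_eq_fintype_card, Fintype.card_subtype]
  omega

lemma isUnit_one_add (n : ℕ) {R : Type*} [CommRing R] [IsDomain R] (hodd : Odd n) (x : R) (hx : x ^ n = 1)
    (h1 : x ≠ 1) : IsUnit (1 + x) := by
  obtain ⟨k, hk⟩ := hodd
  refine IsUnit.of_mul_eq_one (∑ i ∈ Finset.range (k + 1), (x ^ 2) ^ i) ?_
  have h2 := mul_neg_geom_sum (x ^ 2) (k + 1)
  have h3 : (x ^ 2) ^ (k + 1) = x := by
    rw [← pow_mul, show 2 * (k + 1) = n + 1 by omega, pow_succ, hx, one_mul]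
  rw [h3] at h2
  apply mul_left_cancel₀ (sub_ne_zero.2 h1.symm)
  linear_combination h2

section KK
variable (n : ℕ) [NeZero n]

instance cycInst : IsCyclotomicExtension {n} ℚ (CyclotomicField n ℚ) := by
  have : NeZero ((n : ℕ) : ℚ) := ⟨by exact_mod_cast NeZero.ne n⟩
  exact CyclotomicField.isCyclotomicExtension n ℚ

lemma exists_psi : ∃ (ζ : CyclotomicField n ℚ) (ψ : (ZMod n)ˣ → (CyclotomicField n ℚ →+* ℂ)),
    IsPrimitiveRoot ζ n ∧ ∀ a (k : ℕ), ψ a (ζ ^ k) = ZMod.stdAddChar ((a : ZMod n) * (k : ZMod n)) := by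
  have hζ := IsCyclotomicExtension.zeta_spec n ℚ (CyclotomicField n ℚ)
  have hirr := Polynomial.cyclotomic.irreducible_rat (NeZero.pos n)
  have hprim : ∀ a : (ZMod n)ˣ, IsPrimitiveRoot (ZMod.stdAddChar (a : ZMod n) : ℂ) n := by
    intro a
    have h1 : IsPrimitiveRoot (omega n) n := Complex.isPrimitiveRoot_exp n (NeZero.ne n)
    have := h1.pow_of_coprime _ (ZMod.val_coe_unit_coprime a)
    rwa [omega_pow, ZMod.natCast_zmod_val] at this
  refine ⟨_, fun a => ((hζ.embeddingsEquivPrimitiveRoots ℂ hirr).symm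
    ⟨_, (mem_primitiveRoots (NeZero.pos n)).2 (hprim a)⟩ : CyclotomicField n ℚ →ₐ[ℚ] ℂ).toRingHom,
    hζ, fun a k => ?_⟩
  have h := hζ.embeddingsEquivPrimitiveRoots_apply_coe ℂ hirr
    ((hζ.embeddingsEquivPrimitiveRoots ℂ hirr).symm
    ⟨_, (mem_primitiveRoots (NeZero.pos n)).2 (hprim a)⟩)
  rw [Equiv.apply_symm_apply] at h
  rw [map_pow]
  change (DFunLike.coe (F := CyclotomicField n ℚ →ₐ[ℚ] ℂ) _ _) ^ k = _
  rw [← h, mul_comm, ← nsmul_eq_mul, AddChar.map_nsmul_eq_pow]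

lemma exists_hom : ∃ f : Additive (Kgrp n) →+ ((ZMod n)ˣ → ℂ), ∀ (j : ℕ) (x : Kgrp n),
    ((x : ℂˣ) : ℂ) = 1 + ZMod.stdAddChar (j : ZMod n) → f (Additive.ofMul x) =
      fun a : (ZMod n)ˣ => (Real.log ‖1 + (ZMod.stdAddChar ((a : ZMod n) * (j : ZMod n)) : ℂ)‖ : ℂ) := by
  obtain ⟨ζ, ψ, hζ, hψ⟩ := exists_psi n
  have hψ1 : ∀ k : ℕ, ψ 1 (ζ ^ k) = ZMod.stdAddChar (k : ZMod n) := fun k => by simpa using hψ 1 k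
  have hr : Kgrp n ≤ (Units.map (ψ 1 : CyclotomicField n ℚ →* ℂ)).range := by
    rw [Kgrp, Subgroup.closure_le]
    rintro u ⟨j, -, hu⟩
    have h1 : ψ 1 (1 + ζ ^ j) = u := by rw [hu, omega_pow, map_add, map_one, hψ1]
    have h2 : 1 + ζ ^ j ≠ 0 := fun h => by
      rw [h, map_zero] at h1; exact u.ne_zero h1.symm
    exact ⟨Units.mk0 _ h2, Units.ext h1⟩
  choose y hy using fun x : Kgrp n => hr x.2
  have hy' : ∀ x : Kgrp n, ψ 1 (y x) = (x : ℂˣ) := fun x => congrArg Units.val (hy x)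
  have hmul : ∀ x x', (y (x * x') : CyclotomicField n ℚ) = y x * y x' := fun x x' => by
    apply (ψ 1).injective
    rw [hy', map_mul, hy', hy']; rfl
  refine ⟨AddMonoidHom.mk' (fun x a => (Real.log ‖ψ a (y x.toMul)‖ : ℂ)) ?_, ?_⟩
  · intro x x'
    funext a
    simp only [toMul_add, hmul, map_mul, norm_mul, Pi.add_apply]
    rw [Real.log_mul]
    · push_cast; rfl
    · simp
    · simp
  · intro j x hx
    have : (y x : CyclotomicField n ℚ) = 1 + ζ ^ j := by
      apply (ψ 1).injective
      rw [hy', map_add, map_one, hψ1, hx]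
    funext a
    simp [this, hψ, -map_pow]

lemma lower (hn : 3 ≤ n) (h : OFS n) : ((n.totient / 2 : ℕ) : Cardinal) ≤ groupRank (Kgrp n) := by
  obtain ⟨f, hf⟩ := exists_hom n
  rw [← card_even n hn, Nat.card_eq_fintype_card, ← Cardinal.mk_fintype]
  refine le_groupRank (Kgrp n) f (fun χ a => χ.1 a) ?_ ?_
  · have h1 := linearIndependent_monoidHom (ZMod n)ˣ ℂ
    refine h1.comp (fun χ : {χ : DirichletCharacter ℂ n // χ (-1) = 1} =>
      ((χ.1 : ZMod n →* ℂ).comp (Units.coeHom (ZMod n)))) ?_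
    intro χ χ' hh
    apply Subtype.ext
    ext b
    exact DFunLike.congr_fun hh b
  · rintro ⟨χ, he⟩
    obtain ⟨j, hj⟩ := exists_plus n h χ he
    set S := ∑ b : (ZMod n)ˣ, χ⁻¹ b *
      (Real.log ‖1 + (ZMod.stdAddChar ((b : ZMod n) * j) : ℂ)‖ : ℂ) with hS
    have hmem : ∀ k : ZMod n, (fun a : (ZMod n)ˣ =>
        (Real.log ‖1 + (ZMod.stdAddChar ((a : ZMod n) * k) : ℂ)‖ : ℂ)) ∈ Set.range f := by
      intro k
      have hk : (1 + ZMod.stdAddChar k : ℂ) ≠ 0 := by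
        intro h0
        have h1 : (ZMod.stdAddChar k : ℂ) ^ n = 1 := by
          rw [← AddChar.map_nsmul_eq_pow]; simp
        rw [eq_neg_of_add_eq_zero_right h0, h.1.neg_one_pow] at h1
        norm_num at h1
      have hkm : Units.mk0 _ hk ∈ Kgrp n := by
        apply Subgroup.subset_closure
        refine ⟨k.val, ZMod.val_lt k, ?_⟩
        rw [omega_pow, ZMod.natCast_zmod_val]; rfl
      refine ⟨Additive.ofMul ⟨_, hkm⟩, ?_⟩
      rw [hf k.val ⟨_, hkm⟩ (by rw [ZMod.natCast_zmod_val]; rfl), ZMod.natCast_zmod_val]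
    have key : (fun a : (ZMod n)ˣ => χ a) = S⁻¹ • ∑ b : (ZMod n)ˣ, χ⁻¹ b • (fun a : (ZMod n)ˣ =>
        (Real.log ‖1 + (ZMod.stdAddChar ((a : ZMod n) * ((b : ZMod n) * j)) : ℂ)‖ : ℂ)) := by
      funext a
      simp only [Pi.smul_apply, Finset.sum_apply, smul_eq_mul]
      rw [eq_inv_mul_iff_mul_eq₀ hj, hS, mul_comm, Finset.mul_sum]
      symm
      refine Fintype.sum_equiv (Equiv.mulLeft a) _ _ fun b => ?_
      simp only [Equiv.coe_mulLeft, Units.val_mul, map_mul, mul_assoc]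
      have : χ a * χ⁻¹ a = 1 := by
        rw [← MulChar.mul_apply, mul_inv_cancel, MulChar.one_apply_coe]
      linear_combination (- χ⁻¹ b * (Real.log ‖1 + (ZMod.stdAddChar ((a : ZMod n) * ((b : ZMod n) * j)) : ℂ)‖ : ℂ)) * this
    change (fun a : (ZMod n)ˣ => χ a) ∈ _
    rw [key]
    refine Submodule.smul_mem _ _ (Submodule.sum_mem _ fun b _ => Submodule.smul_mem _ _ ?_)
    exact Submodule.subset_span (hmem _)

lemma upper (hn : 3 ≤ n) (h : OFS n) : groupRank (Kgrp n) ≤ ((n.totient / 2 : ℕ) : Cardinal) := by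
  obtain ⟨ζ, ψ, hζ, hψ⟩ := exists_psi n
  have hψ1 : ∀ k : ℕ, ψ 1 (ζ ^ k) = ZMod.stdAddChar (k : ZMod n) := fun k => by simpa using hψ 1 k
  let K := CyclotomicField n ℚ
  let α : (NumberField.RingOfIntegers K)ˣ →* ℂˣ :=
    Units.map (((ψ 1).comp (algebraMap (NumberField.RingOfIntegers K) K) :
      NumberField.RingOfIntegers K →+* ℂ) : NumberField.RingOfIntegers K →* ℂ)
  let A : Additive (NumberField.RingOfIntegers K)ˣ →ₗ[ℤ] Additive ℂˣ :=
    (MonoidHom.toAdditive α).toIntLinearMap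
  let B : ℤ →ₗ[ℤ] Additive ℂˣ :=
    LinearMap.toSpanSingleton ℤ _ (Additive.ofMul (Units.mk0 2 two_ne_zero))
  let I : Additive (Kgrp n) →ₗ[ℤ] Additive ℂˣ :=
    (MonoidHom.toAdditive (Kgrp n).subtype).toIntLinearMap
  have hle : Kgrp n ≤ AddSubgroup.toSubgroup'
      (Submodule.toAddSubgroup (LinearMap.range A ⊔ LinearMap.range B)) := by
    rw [Kgrp, Subgroup.closure_le]
    rintro u ⟨j, hjn, hu⟩
    change Additive.ofMul u ∈ LinearMap.range A ⊔ LinearMap.range B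
    by_cases hj : j = 0
    · apply Submodule.mem_sup_right
      refine ⟨1, ?_⟩
      simp only [B, LinearMap.toSpanSingleton_apply, one_smul]
      congr 1
      apply Units.ext
      rw [hu, hj]; norm_num
    · apply Submodule.mem_sup_left
      let z : NumberField.RingOfIntegers K := hζ.toInteger
      have hz : (algebraMap (NumberField.RingOfIntegers K) K) z = ζ := rfl
      have hz' : IsPrimitiveRoot z n := hζ.toInteger_isPrimitiveRoot
      have hun : IsUnit (1 + z ^ j) := by
        apply isUnit_one_add n h.1
        · rw [pow_right_comm, hz'.pow_eq_one, one_pow]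
        · exact hz'.pow_ne_one_of_pos_of_lt hj hjn
      refine ⟨Additive.ofMul hun.unit, ?_⟩
      change Additive.ofMul (α hun.unit) = _
      congr 1
      apply Units.ext
      rw [hu, omega_pow, ← hψ1]
      change ψ 1 (algebraMap _ K (1 + z ^ j)) = _
      rw [map_add, map_pow, hz]; simp
  rw [groupRank_eq]
  have h1 : Module.rank ℤ (Additive (Kgrp n)) ≤
      Module.rank ℤ ↥(LinearMap.range A ⊔ LinearMap.range B) := by
    refine LinearMap.rank_le_of_injective (I.codRestrict (LinearMap.range A ⊔ LinearMap.range B)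
      fun x => hle x.toMul.2) ?_
    intro x x' hh
    have : I x = I x' := congrArg (Submodule.subtype _) hh
    apply Additive.toMul.injective
    exact Subtype.ext this
  have h2 := Submodule.rank_add_le_rank_add_rank (LinearMap.range A) (LinearMap.range B)
  have h3 : Module.rank ℤ (LinearMap.range A) ≤ ((n.totient / 2 - 1 : ℕ) : Cardinal) := by
    refine (rank_range_le A).trans ?_
    rw [← Module.finrank_eq_rank, NumberField.Units.finrank_eq]
    rw [NumberField.Units.rank, NumberField.InfinitePlace.card_eq_nrRealPlaces_add_nrComplexPlaces,
      IsCyclotomicExtension.Rat.nrComplexPlaces_eq_totient_div_two n K,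
      IsCyclotomicExtension.Rat.nrRealPlaces_eq_zero K (n := n) (by omega), zero_add]
  have h4 : Module.rank ℤ (LinearMap.range B) ≤ 1 := by
    simpa using (rank_range_le B)
  refine h1.trans (h2.trans ((add_le_add h3 h4).trans ?_))
  have h5 : 0 < n.totient := Nat.totient_pos.2 (by omega)
  have h6 := Nat.totient_even (n := n) (by omega)
  obtain ⟨k, hk⟩ := h6
  have : n.totient / 2 - 1 + 1 = n.totient / 2 := by omega
  exact_mod_cast this.le

end KK

lemma rank_one : groupRank (Kgrp 1) = 1 := by
  let t : ℂˣ := Units.mk0 2 two_ne_zero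
  have hK : Kgrp 1 = Subgroup.zpowers t := by
    rw [Kgrp, Subgroup.zpowers_eq_closure]
    congr 1
    ext u
    simp only [Set.mem_ofPred_eq, Set.mem_singleton_iff]
    constructor
    · rintro ⟨j, hj, hu⟩
      apply Units.ext
      rw [hu, Nat.lt_one_iff.1 hj]; norm_num [t]
    · rintro rfl
      exact ⟨0, by norm_num, by norm_num [t]⟩
  apply le_antisymm
  · rw [groupRank_eq]
    let T : Kgrp 1 := ⟨t, hK ▸ Subgroup.mem_zpowers t⟩
    have hs : Function.Surjective (LinearMap.toSpanSingleton ℤ (Additive (Kgrp 1)) (Additive.ofMul T)) := by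
      intro x
      have hx := x.toMul.2
      obtain ⟨k, hk⟩ := Subgroup.mem_zpowers_iff.1 (hK.le hx)
      refine ⟨k, ?_⟩
      apply Additive.toMul.injective
      apply Subtype.ext
      simpa [T] using hk
    simpa using LinearMap.rank_le_of_surjective _ hs
  · let f : Additive (Kgrp 1) →+ ℂ := AddMonoidHom.mk'
      (fun x => (Real.log ‖((x.toMul : ℂˣ) : ℂ)‖ : ℂ)) (by
        intro x y
        simp only [toMul_add, Subgroup.coe_mul, Units.val_mul, norm_mul]
        rw [Real.log_mul (by simp) (by simp)]
        push_cast; rfl)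
    have h2 : Real.log 2 ≠ 0 := (Real.log_pos (by norm_num)).ne'
    have := le_groupRank (Kgrp 1) f (fun _ : Unit => (Real.log 2 : ℂ))
      (LinearIndependent.of_subsingleton () (by exact_mod_cast h2)) (fun _ => by
        apply Submodule.subset_span
        refine ⟨Additive.ofMul ⟨t, hK ▸ Subgroup.mem_zpowers t⟩, ?_⟩
        simp [f, t])
    simpa using this

/-- For `n ≥ 3` in `O_FS`, the rank of `K_n` is `φ(n)/2`; moreover the rank of `K_1` is `1`. -/
theorem rank_Kn :
    (∀ n : ℕ, 3 ≤ n → OFS n →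
      groupRank (Kgrp n) = ((Nat.totient n / 2 : ℕ) : Cardinal)) ∧
    groupRank (Kgrp 1) = 1 := by
  refine ⟨fun n hn h => ?_, rank_one⟩
  have : NeZero n := ⟨by omega⟩
  exact le_antisymm (upper n hn h) (lower n hn h)
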